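/- Fix K, G > 0, c₀ > 0, φ, ψ ∈ (0, π/2) and a nondecreasing continuous function H : ℝ → ℝ with H(0) = 0. Then for every σᵗʳ ∈ Sym3 and every ε̄ᵗʳ ∈ ℝ, there exists exactly one triple (σ, ε̄ᵖ, Δλ) ∈ Sym3 × ℝ × ℝ such that: Δλ ≥ 0; ε̄ᵖ = ε̄ᵗʳ + 2Δλ·cos φ; f(σ, H(ε̄ᵖ)) ≤ 0; Δλ·f(σ, H(ε̄ᵖ)) = 0; and there exists ν ∈ ∂g(σ) with σ = σᵗʳ − Δλ·D_e(ν). (Existence and uniqueness of the solution to the implicitly discretized Mohr–Coulomb constitutive problem.) -/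

import Mathlib

open Matrix

/-- The space of 3×3 real matrices. -/
abbrev Mat3 := Matrix (Fin 3) (Fin 3) ℝ

/-- The Frobenius inner product ⟨A,B⟩ = trace (A·B). -/
noncomputable def frob (A B : Mat3) : ℝ := (A * B).trace

/-- Eigenvalues of a symmetric (Hermitian) 3×3 real matrix, sorted in decreasing order:
`ordEig A 0 ≥ ordEig A 1 ≥ ordEig A 2`.  Junk value `0` if `A` is not symmetric. -/
noncomputable def ordEig (A : Mat3) (i : Fin 3) : ℝ :=
  if h : A.IsHermitian then
    (List.insertionSort (· ≥ ·) (List.ofFn h.eigenvalues)).getD i.1 0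
  else 0

/-- ω₁: the largest eigenvalue. -/
noncomputable def ω₁ (A : Mat3) : ℝ := ordEig A 0
/-- ω₂: the middle eigenvalue. -/
noncomputable def ω₂ (A : Mat3) : ℝ := ordEig A 1
/-- ω₃: the smallest eigenvalue. -/
noncomputable def ω₃ (A : Mat3) : ℝ := ordEig A 2

/-- The subdifferential (relative to the space of symmetric matrices) of `g` at `η`. -/
def subdiff (g : Mat3 → ℝ) (η : Mat3) : Set Mat3 :=
  {ν | ν.IsHermitian ∧ ∀ τ : Mat3, τ.IsHermitian → g η + frob ν (τ - η) ≤ g τ}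

/-- `V(η)`: admissible ordered orthonormal eigenbases of `η`. -/
def Vset (η : Mat3) : Set (Fin 3 → (Fin 3 → ℝ)) :=
  {e | (∀ i j, e i ⬝ᵥ e j = if i = j then (1 : ℝ) else 0) ∧
       (∀ i, η.mulVec (e i) = ordEig η i • e i)}

/-- The Mohr–Coulomb yield function `f(σ,κ)`. -/
noncomputable def MCf (φ c₀ : ℝ) (σ : Mat3) (κ : ℝ) : ℝ :=
  (1 + Real.sin φ) * ω₁ σ - (1 - Real.sin φ) * ω₃ σ - 2 * (c₀ + κ) * Real.cos φ

/-- The Mohr–Coulomb plastic potential `g(σ)`. -/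
noncomputable def MCg (ψ : ℝ) (σ : Mat3) : ℝ :=
  (1 + Real.sin ψ) * ω₁ σ - (1 - Real.sin ψ) * ω₃ σ

/-- The linear isotropic elastic tensor `D_e`. -/
noncomputable def De (K G : ℝ) (ν : Mat3) : Mat3 :=
  ((1 / 3) * (3 * K - 2 * G) * ν.trace) • (1 : Mat3) + (2 * G) • ν

/-- Quadratic form. -/
noncomputable def qf (A : Mat3) (u : Fin 3 → ℝ) : ℝ := u ⬝ᵥ (A *ᵥ u)

lemma qf_diag (U : Mat3) (d : Fin 3 → ℝ) (u : Fin 3 → ℝ) :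
    qf (U * diagonal d * Uᵀ) u = ∑ i, d i * ((Uᵀ *ᵥ u) i) ^ 2 := by
  unfold qf
  simp [Matrix.mul_apply, Matrix.mulVec, dotProduct, Fin.sum_univ_three, diagonal]
  ring

lemma norm_rot (U : Mat3) (hU : U * Uᵀ = 1) (u : Fin 3 → ℝ) :
    ∑ i, ((Uᵀ *ᵥ u) i) ^ 2 = u ⬝ᵥ u := by
  have h := qf_diag U (fun _ => 1) u
  rw [show diagonal (fun _ : Fin 3 => (1:ℝ)) = 1 from diagonal_one, mul_one, hU] at h
  simp [qf] at h
  exact h.symm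

lemma spectral (A : Mat3) (h : A.IsHermitian) :
    ∃ U : Mat3, U * Uᵀ = 1 ∧ Uᵀ * U = 1 ∧ A = U * diagonal h.eigenvalues * Uᵀ := by
  refine ⟨(h.eigenvectorUnitary : Mat3), ?_, ?_, ?_⟩
  · have := (Matrix.mem_unitaryGroup_iff).1 h.eigenvectorUnitary.2
    simpa [star_eq_conjTranspose] using this
  · have := (Matrix.mem_unitaryGroup_iff').1 h.eigenvectorUnitary.2
    simpa [star_eq_conjTranspose] using this
  · have := h.spectral_theorem
    simpa [Unitary.conjStarAlgAut_apply, star_eq_conjTranspose, Function.comp_def] using this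

lemma sorted_ends (v : Fin 3 → ℝ) :
    ((∀ i, v i ≤ (List.insertionSort (· ≥ ·) (List.ofFn v)).getD 0 0) ∧
      ∃ i, v i = (List.insertionSort (· ≥ ·) (List.ofFn v)).getD 0 0) ∧
    ((∀ i, (List.insertionSort (· ≥ ·) (List.ofFn v)).getD 2 0 ≤ v i) ∧
      ∃ i, v i = (List.insertionSort (· ≥ ·) (List.ofFn v)).getD 2 0) := by
  have hs := List.pairwise_insertionSort (· ≥ ·) (List.ofFn v)
  have hl : (List.insertionSort (· ≥ ·) (List.ofFn v)).length = 3 := by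
    rw [List.length_insertionSort]; simp
  have hm : ∀ r, r ∈ List.insertionSort (· ≥ ·) (List.ofFn v) ↔ ∃ i, v i = r := by
    intro r; rw [List.mem_insertionSort, List.mem_ofFn]
  generalize List.insertionSort (· ≥ ·) (List.ofFn v) = L at *
  match L, hl with
  | [p, q, r], _ =>
    simp at hs hm ⊢
    obtain ⟨⟨h1, h2⟩, h3⟩ := hs
    refine ⟨⟨fun i => ?_, (hm p).1 (by simp)⟩, ⟨fun i => ?_, (hm r).1 (by simp)⟩⟩
    · rcases (hm (v i)).2 ⟨i, rfl⟩ with h | h | h <;> linarith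
    · rcases (hm (v i)).2 ⟨i, rfl⟩ with h | h | h <;> linarith

lemma qf_col (U : Mat3) (hU : Uᵀ * U = 1) (d : Fin 3 → ℝ) (i : Fin 3) :
    (fun k => U k i) ⬝ᵥ (fun k => U k i) = 1 ∧
    qf (U * diagonal d * Uᵀ) (fun k => U k i) = d i := by
  have h1 : Uᵀ *ᵥ (fun k => U k i) = fun j => if j = i then 1 else 0 := by
    ext j
    have := congrFun (congrFun hU j) i
    simpa [Matrix.mul_apply, Matrix.mulVec, dotProduct, Matrix.one_apply] using this
  constructor
  · have := congrFun (congrFun hU i) i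
    simpa [Matrix.mul_apply, dotProduct] using this
  · rw [qf_diag, h1]; simp

lemma qf_bounds (A : Mat3) (h : A.IsHermitian) (u : Fin 3 → ℝ) (hu : u ⬝ᵥ u = 1) :
    ω₃ A ≤ qf A u ∧ qf A u ≤ ω₁ A := by
  obtain ⟨U, h1, h2, h3⟩ := spectral A h
  have hn := norm_rot U h1 u
  have hq := qf_diag U h.eigenvalues u
  rw [← h3] at hq
  obtain ⟨⟨ha, -⟩, ⟨hb, -⟩⟩ := sorted_ends h.eigenvalues
  have e1 : ω₁ A = (List.insertionSort (· ≥ ·) (List.ofFn h.eigenvalues)).getD 0 0 := by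
    unfold ω₁ ordEig; rw [dif_pos h]; rfl
  have e3 : ω₃ A = (List.insertionSort (· ≥ ·) (List.ofFn h.eigenvalues)).getD 2 0 := by
    unfold ω₃ ordEig; rw [dif_pos h]; rfl
  rw [← e1] at ha
  rw [← e3] at hb
  rw [hq]
  rw [hu] at hn
  constructor
  · calc ω₃ A = ∑ i, ω₃ A * ((Uᵀ *ᵥ u) i) ^ 2 := by rw [← Finset.mul_sum, hn, mul_one]
      _ ≤ _ := Finset.sum_le_sum fun i _ => mul_le_mul_of_nonneg_right (hb i) (sq_nonneg _)
  · calc _ ≤ ∑ i, ω₁ A * ((Uᵀ *ᵥ u) i) ^ 2 :=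
          Finset.sum_le_sum fun i _ => mul_le_mul_of_nonneg_right (ha i) (sq_nonneg _)
      _ = _ := by rw [← Finset.mul_sum, hn, mul_one]

lemma qf_attained (A : Mat3) (h : A.IsHermitian) :
    (∃ u, u ⬝ᵥ u = 1 ∧ qf A u = ω₁ A) ∧ (∃ u, u ⬝ᵥ u = 1 ∧ qf A u = ω₃ A) := by
  obtain ⟨U, h1, h2, h3⟩ := spectral A h
  obtain ⟨⟨-, i, hi⟩, ⟨-, j, hj⟩⟩ := sorted_ends h.eigenvalues
  have e1 : ω₁ A = (List.insertionSort (· ≥ ·) (List.ofFn h.eigenvalues)).getD 0 0 := by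
    unfold ω₁ ordEig; rw [dif_pos h]; rfl
  have e3 : ω₃ A = (List.insertionSort (· ≥ ·) (List.ofFn h.eigenvalues)).getD 2 0 := by
    unfold ω₃ ordEig; rw [dif_pos h]; rfl
  have k1 := qf_col U h2 h.eigenvalues i
  have k2 := qf_col U h2 h.eigenvalues j
  rw [← h3] at k1 k2
  exact ⟨⟨_, k1.1, by rw [k1.2, hi, e1]⟩, ⟨_, k2.1, by rw [k2.2, hj, e3]⟩⟩

lemma herm_rot (U : Mat3) (d : Fin 3 → ℝ) : (U * diagonal d * Uᵀ).IsHermitian := by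
  unfold Matrix.IsHermitian
  rw [conjTranspose_eq_transpose_of_trivial]
  simp [Matrix.transpose_mul, Matrix.mul_assoc]

lemma omega_rot (U : Mat3) (hU : U * Uᵀ = 1) (hU' : Uᵀ * U = 1) (x : Fin 3 → ℝ)
    (h01 : x 1 ≤ x 0) (h12 : x 2 ≤ x 1) :
    ω₁ (U * diagonal x * Uᵀ) = x 0 ∧ ω₃ (U * diagonal x * Uᵀ) = x 2 := by
  have hh := herm_rot U x
  obtain ⟨⟨u, hu, hu'⟩, ⟨w, hw, hw'⟩⟩ := qf_attained _ hh
  have c0 := qf_col U hU' x 0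
  have c2 := qf_col U hU' x 2
  have b0 := (qf_bounds _ hh _ c0.1).2
  have b2 := (qf_bounds _ hh _ c2.1).1
  rw [c0.2] at b0
  rw [c2.2] at b2
  have nu := norm_rot U hU u
  have nw := norm_rot U hU w
  rw [qf_diag] at hu' hw'
  rw [hu] at nu
  rw [hw] at nw
  simp only [Fin.sum_univ_three] at nu nw hu' hw'
  constructor
  · apply le_antisymm _ b0
    rw [← hu']
    have nu' := congrArg (fun r => x 0 * r) nu
    simp only [mul_add, mul_one] at nu'
    linarith [sq_nonneg ((Uᵀ *ᵥ u) 1), sq_nonneg ((Uᵀ *ᵥ u) 2),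
      mul_nonneg (sub_nonneg.2 h01) (sq_nonneg ((Uᵀ *ᵥ u) 1)),
      mul_nonneg (sub_nonneg.2 (h12.trans h01)) (sq_nonneg ((Uᵀ *ᵥ u) 2))]
  · apply le_antisymm b2
    rw [← hw']
    have nw' := congrArg (fun r => x 2 * r) nw
    simp only [mul_add, mul_one] at nw'
    linarith [mul_nonneg (sub_nonneg.2 h12) (sq_nonneg ((Uᵀ *ᵥ w) 1)),
      mul_nonneg (sub_nonneg.2 (h12.trans h01)) (sq_nonneg ((Uᵀ *ᵥ w) 0))]

lemma frob_rot (U : Mat3) (d : Fin 3 → ℝ) (B : Mat3) :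
    frob (U * diagonal d * Uᵀ) B = ∑ i, d i * qf B (fun k => U k i) := by
  simp [frob, qf, Matrix.trace, Matrix.mul_apply, Matrix.mulVec, dotProduct, Fin.sum_univ_three,
    diagonal]
  ring

lemma frob_sub (A B C : Mat3) : frob A (B - C) = frob A B - frob A C := by
  simp [frob, Matrix.mul_sub, Matrix.trace_sub]

/-- Subgradients built from simplex weights. -/
lemma subdiff_rot (ψ : ℝ) (hψ : ψ ∈ Set.Ioo 0 (Real.pi / 2))
    (U : Mat3) (hU : U * Uᵀ = 1) (hU' : Uᵀ * U = 1) (x p q : Fin 3 → ℝ)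
    (h01 : x 1 ≤ x 0) (h12 : x 2 ≤ x 1)
    (hp : ∀ i, 0 ≤ p i) (hq : ∀ i, 0 ≤ q i) (sp : ∑ i, p i = 1) (sq : ∑ i, q i = 1)
    (cp : ∀ i, p i * (x 0 - x i) = 0) (cq : ∀ i, q i * (x i - x 2) = 0) :
    U * diagonal (fun i => (1 + Real.sin ψ) * p i - (1 - Real.sin ψ) * q i) * Uᵀ ∈
      subdiff (MCg ψ) (U * diagonal x * Uᵀ) := by
  have ha : 0 ≤ 1 + Real.sin ψ := by linarith [Real.neg_one_le_sin ψ]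
  have hb : 0 ≤ 1 - Real.sin ψ := by linarith [Real.sin_le_one ψ]
  refine ⟨herm_rot _ _, fun τ hτ => ?_⟩
  rw [frob_sub, frob_rot, frob_rot]
  obtain ⟨o1, o3⟩ := omega_rot U hU hU' x h01 h12
  simp only [MCg, o1, o3, fun i => (qf_col U hU' x i).2]
  have B := fun i => qf_bounds τ hτ _ (qf_col U hU' x i).1
  set r : Fin 3 → ℝ := fun i => qf τ (fun k => U k i) with hr
  change ∀ i, ω₃ τ ≤ r i ∧ r i ≤ ω₁ τ at B
  change _ + ((∑ i, _ * r i) - _) ≤ _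
  generalize 1 + Real.sin ψ = a at *
  generalize 1 - Real.sin ψ = b at *
  have P1 : ∑ i, p i * r i ≤ ω₁ τ := by
    calc _ ≤ ∑ i, p i * ω₁ τ :=
          Finset.sum_le_sum fun i _ => mul_le_mul_of_nonneg_left (B i).2 (hp i)
      _ = _ := by rw [← Finset.sum_mul, sp, one_mul]
  have Q1 : ω₃ τ ≤ ∑ i, q i * r i := by
    calc _ = ∑ i, q i * ω₃ τ := by rw [← Finset.sum_mul, sq, one_mul]
      _ ≤ _ := Finset.sum_le_sum fun i _ => mul_le_mul_of_nonneg_left (B i).1 (hq i)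
  have P2 : ∑ i, p i * x i = x 0 := by
    calc _ = ∑ i, p i * x 0 := Finset.sum_congr rfl fun i _ => by linarith [cp i]
      _ = _ := by rw [← Finset.sum_mul, sp, one_mul]
  have Q2 : ∑ i, q i * x i = x 2 := by
    calc _ = ∑ i, q i * x 2 := Finset.sum_congr rfl fun i _ => by linarith [cq i]
      _ = _ := by rw [← Finset.sum_mul, sq, one_mul]
  have E : ∀ v : Fin 3 → ℝ, ∑ i, (a * p i - b * q i) * v i
      = a * ∑ i, p i * v i - b * ∑ i, q i * v i := by
    intro v; simp only [Fin.sum_univ_three]; ring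
  rw [E, E, P2, Q2]
  nlinarith [mul_le_mul_of_nonneg_left P1 ha, mul_le_mul_of_nonneg_left Q1 hb]

/-- Largest, smallest eigenvalue of the proximal point. -/
noncomputable def mm (a b : ℝ) (y : Fin 3 → ℝ) (t : ℝ) : ℝ := (y 0 + y 1 + y 2 - (a - b) * t) / 3
noncomputable def xt (a b : ℝ) (y : Fin 3 → ℝ) (t : ℝ) : ℝ :=
  max (max (y 0 - a * t) ((y 0 + y 1 - a * t) / 2)) (mm a b y t)
noncomputable def xb (a b : ℝ) (y : Fin 3 → ℝ) (t : ℝ) : ℝ :=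
  min (min (y 2 + b * t) ((y 1 + y 2 + b * t) / 2)) (mm a b y t)
noncomputable def xx (a b : ℝ) (y : Fin 3 → ℝ) (t : ℝ) : Fin 3 → ℝ :=
  ![xt a b y t, 3 * mm a b y t - xt a b y t - xb a b y t, xb a b y t]

/-- The weights, from abstract optimality facts. -/
lemma weights_aux (a b t : ℝ) (ha : 0 < a) (hb : 0 < b) (ht : 0 < t) (y0 y1 y2 x0 x1 x2 : ℝ)
    (hy01 : y1 ≤ y0) (hy12 : y2 ≤ y1)
    (P0 P1 P2 Q0 Q1 Q2 : ℝ) (hP0 : 0 ≤ P0) (hP1 : 0 ≤ P1) (hP2 : 0 ≤ P2)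
    (hQ0 : 0 ≤ Q0) (hQ1 : 0 ≤ Q1) (hQ2 : 0 ≤ Q2)
    (e0 : y0 - x0 = P0 - Q0) (e1 : y1 - x1 = P1 - Q1) (e2 : y2 - x2 = P2 - Q2)
    (sP : P0 + P1 + P2 = a * t) (sQ : Q0 + Q1 + Q2 = b * t)
    (p1 : P1 * (x0 - x1) = 0) (p2 : P2 * (x0 - x2) = 0)
    (q0 : Q0 * (x0 - x2) = 0) (q1 : Q1 * (x1 - x2) = 0) :
    ∃ p q : Fin 3 → ℝ, (∀ i, 0 ≤ p i) ∧ (∀ i, 0 ≤ q i) ∧ ∑ i, p i = 1 ∧ ∑ i, q i = 1 ∧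
      (∀ i, p i * (x0 - ![x0, x1, x2] i) = 0) ∧ (∀ i, q i * (![x0, x1, x2] i - x2) = 0) ∧
      ∀ i, ![y0, y1, y2] i - ![x0, x1, x2] i = t * (a * p i - b * q i) := by
  have hat : 0 < a * t := mul_pos ha ht
  have hbt : 0 < b * t := mul_pos hb ht
  refine ⟨![P0 / (a * t), P1 / (a * t), P2 / (a * t)],
    ![Q0 / (b * t), Q1 / (b * t), Q2 / (b * t)], ?_, ?_, ?_, ?_, ?_, ?_, ?_⟩
  · intro i; fin_cases i <;> simp <;> positivity
  · intro i; fin_cases i <;> simp <;> positivity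
  · simp [Fin.sum_univ_three]; rw [← add_div, ← add_div, sP, div_self hat.ne']
  · simp [Fin.sum_univ_three]; rw [← add_div, ← add_div, sQ, div_self hbt.ne']
  · intro i
    fin_cases i
    · simp
    · change P1 / (a * t) * (x0 - x1) = 0
      rw [div_mul_eq_mul_div, p1, zero_div]
    · change P2 / (a * t) * (x0 - x2) = 0
      rw [div_mul_eq_mul_div, p2, zero_div]
  · intro i
    fin_cases i
    · change Q0 / (b * t) * (x0 - x2) = 0
      rw [div_mul_eq_mul_div, q0, zero_div]
    · change Q1 / (b * t) * (x1 - x2) = 0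
      rw [div_mul_eq_mul_div, q1, zero_div]
    · simp
  · intro i
    fin_cases i
    · change y0 - x0 = t * (a * (P0 / (a * t)) - b * (Q0 / (b * t)))
      rw [e0]; field_simp
    · change y1 - x1 = t * (a * (P1 / (a * t)) - b * (Q1 / (b * t)))
      rw [e1]; field_simp
    · change y2 - x2 = t * (a * (P2 / (a * t)) - b * (Q2 / (b * t)))
      rw [e2]; field_simp

lemma scalar_sorted (a b t : ℝ) (ha : 0 < a) (hb : 0 < b) (ht : 0 ≤ t) (y : Fin 3 → ℝ)
    (hy01 : y 1 ≤ y 0) (hy12 : y 2 ≤ y 1) :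
    xx a b y t 1 ≤ xx a b y t 0 ∧ xx a b y t 2 ≤ xx a b y t 1 := by
  have hat : 0 ≤ a * t := by positivity
  have hbt : 0 ≤ b * t := by positivity
  have e : mm a b y t = (y 0 + y 1 + y 2 - a * t + b * t) / 3 := by unfold mm; ring
  simp only [xx, Matrix.cons_val]
  unfold xt xb
  rw [e]
  generalize a * t = A at *
  generalize b * t = B at *
  generalize y 0 = y0 at *
  generalize y 1 = y1 at *
  generalize y 2 = y2 at *
  constructor <;> grind

lemma key_aux (A B y0 y1 y2 : ℝ) (hat : 0 < A) (hbt : 0 < B) (hy01 : y1 ≤ y0) (hy12 : y2 ≤ y1) :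
    ∃ P0 P1 P2 Q0 Q1 Q2 : ℝ, 0 ≤ P0 ∧ 0 ≤ P1 ∧ 0 ≤ P2 ∧ 0 ≤ Q0 ∧ 0 ≤ Q1 ∧ 0 ≤ Q2 ∧
    y0 - (max (max (y0 - A) ((y0 + y1 - A) / 2)) ((y0 + y1 + y2 - A + B) / 3)) = P0 - Q0 ∧
    y1 - (3 * ((y0 + y1 + y2 - A + B) / 3) - (max (max (y0 - A) ((y0 + y1 - A) / 2)) ((y0 + y1 + y2 - A + B) / 3)) - (min (min (y2 + B) ((y1 + y2 + B) / 2)) ((y0 + y1 + y2 - A + B) / 3))) = P1 - Q1 ∧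
    y2 - (min (min (y2 + B) ((y1 + y2 + B) / 2)) ((y0 + y1 + y2 - A + B) / 3)) = P2 - Q2 ∧ P0 + P1 + P2 = A ∧ Q0 + Q1 + Q2 = B ∧
    P1 * ((max (max (y0 - A) ((y0 + y1 - A) / 2)) ((y0 + y1 + y2 - A + B) / 3)) - (3 * ((y0 + y1 + y2 - A + B) / 3) - (max (max (y0 - A) ((y0 + y1 - A) / 2)) ((y0 + y1 + y2 - A + B) / 3)) - (min (min (y2 + B) ((y1 + y2 + B) / 2)) ((y0 + y1 + y2 - A + B) / 3)))) = 0 ∧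
    P2 * ((max (max (y0 - A) ((y0 + y1 - A) / 2)) ((y0 + y1 + y2 - A + B) / 3)) - (min (min (y2 + B) ((y1 + y2 + B) / 2)) ((y0 + y1 + y2 - A + B) / 3))) = 0 ∧ Q0 * ((max (max (y0 - A) ((y0 + y1 - A) / 2)) ((y0 + y1 + y2 - A + B) / 3)) - (min (min (y2 + B) ((y1 + y2 + B) / 2)) ((y0 + y1 + y2 - A + B) / 3))) = 0 ∧
    Q1 * ((3 * ((y0 + y1 + y2 - A + B) / 3) - (max (max (y0 - A) ((y0 + y1 - A) / 2)) ((y0 + y1 + y2 - A + B) / 3)) - (min (min (y2 + B) ((y1 + y2 + B) / 2)) ((y0 + y1 + y2 - A + B) / 3))) - (min (min (y2 + B) ((y1 + y2 + B) / 2)) ((y0 + y1 + y2 - A + B) / 3))) = 0 := by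
  set m := (y0 + y1 + y2 - A + B) / 3 with hm
  set h1 := max (y0 - A) ((y0 + y1 - A) / 2) with hh1
  set h3 := min (y2 + B) ((y1 + y2 + B) / 2) with hh3
  by_cases hc : h3 ≤ h1
  · have m1 : max h1 m = h1 := by grind
    have m3 : min h3 m = h3 := by grind
    rw [m1, m3]
    rcases le_total h1 y1 with c | c
    · refine ⟨y0 - h1, y1 - h1, 0, 0, 0, B, ?_⟩
      have : h1 = (y0 + y1 - A) / 2 := by grind
      have : h3 = y2 + B := by grind
      refine ⟨?_, ?_, ?_, ?_, ?_, ?_, ?_, ?_, ?_, ?_, ?_, ?_, ?_, ?_, ?_⟩ <;> grind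
    · have : h1 = y0 - A := by grind
      rcases le_total y1 h3 with d | d
      · have : h3 = (y1 + y2 + B) / 2 := by grind
        refine ⟨A, 0, 0, 0, h3 - y1, h3 - y2, ?_⟩
        refine ⟨?_, ?_, ?_, ?_, ?_, ?_, ?_, ?_, ?_, ?_, ?_, ?_, ?_, ?_, ?_⟩ <;> grind
      · have : h3 = y2 + B := by grind
        refine ⟨A, 0, 0, 0, 0, B, ?_⟩
        refine ⟨?_, ?_, ?_, ?_, ?_, ?_, ?_, ?_, ?_, ?_, ?_, ?_, ?_, ?_, ?_⟩ <;> grind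
  · have m1 : max h1 m = m := by grind
    have m3 : min h3 m = m := by grind
    rw [m1, m3]
    have i1 : y0 - A ≤ m := by grind
    have i2 : (y0 + y1 - A) / 2 ≤ m := by grind
    have hR : max (y0 - m) 0 + max (y1 - m) 0 + max (y2 - m) 0 ≤ A := by
      clear_value h1 h3
      rcases max_cases (y0 - m) 0 with c0 | c0 <;> rcases max_cases (y1 - m) 0 with c1 | c1 <;>
      rcases max_cases (y2 - m) 0 with c2 | c2 <;> linarith
    obtain ⟨R, hRe⟩ : ∃ R, R = A - (max (y0 - m) 0 + max (y1 - m) 0 + max (y2 - m) 0) :=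
      ⟨_, rfl⟩
    have hR0 : 0 ≤ R := by linarith
    have f : ∀ z : ℝ, max z 0 - max (-z) 0 = z := by intro z; grind
    have f0 := f (y0 - m)
    have f1 := f (y1 - m)
    have f2 := f (y2 - m)
    refine ⟨max (y0 - m) 0 + R / 3, max (y1 - m) 0 + R / 3, max (y2 - m) 0 + R / 3,
      max (-(y0 - m)) 0 + R / 3, max (-(y1 - m)) 0 + R / 3, max (-(y2 - m)) 0 + R / 3,
      by positivity, by positivity, by positivity, by positivity, by positivity,
      by positivity, by linarith, by linarith, by linarith, by linarith, by linarith,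
      ?_, ?_, ?_, ?_⟩ <;> ring

lemma weights (a b t : ℝ) (ha : 0 < a) (hb : 0 < b) (ht : 0 ≤ t) (y : Fin 3 → ℝ)
    (hy01 : y 1 ≤ y 0) (hy12 : y 2 ≤ y 1) :
    ∃ p q : Fin 3 → ℝ, (∀ i, 0 ≤ p i) ∧ (∀ i, 0 ≤ q i) ∧ ∑ i, p i = 1 ∧ ∑ i, q i = 1 ∧
      (∀ i, p i * (xx a b y t 0 - xx a b y t i) = 0) ∧
      (∀ i, q i * (xx a b y t i - xx a b y t 2) = 0) ∧
      ∀ i, y i - xx a b y t i = t * (a * p i - b * q i) := by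
  rcases ht.eq_or_lt with rfl | ht
  · have e0 : xx a b y 0 = y := by
      have e1 : xt a b y 0 = y 0 := by
        unfold xt mm; apply le_antisymm
        · apply max_le (max_le _ _) <;> linarith
        · simp
      have e2 : xb a b y 0 = y 2 := by
        unfold xb mm; apply le_antisymm
        · simp
        · apply le_min (le_min _ _) <;> linarith
      ext i; fin_cases i
      · simp [xx, e1]
      · simp [xx, e1, e2, mm]; ring
      · simp [xx, e2]
    rw [e0]
    refine ⟨![1, 0, 0], ![0, 0, 1], ?_, ?_, ?_, ?_, ?_, ?_, ?_⟩
    · intro i; fin_cases i <;> simp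
    · intro i; fin_cases i <;> simp
    · simp [Fin.sum_univ_three]
    · simp [Fin.sum_univ_three]
    · intro i; fin_cases i <;> simp
    · intro i; fin_cases i <;> simp
    · intro i; simp
  · have hat : 0 < a * t := by positivity
    have hbt : 0 < b * t := by positivity
    have e : mm a b y t = (y 0 + y 1 + y 2 - a * t + b * t) / 3 := by unfold mm; ring
    have W := weights_aux a b t ha hb ht (y 0) (y 1) (y 2) (xt a b y t)
      (3 * mm a b y t - xt a b y t - xb a b y t) (xb a b y t) hy01 hy12
    have ey : ![y 0, y 1, y 2] = y := by ext i; fin_cases i <;> rfl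
    rw [ey] at W
    have key : ∃ P0 P1 P2 Q0 Q1 Q2 : ℝ, 0 ≤ P0 ∧ 0 ≤ P1 ∧ 0 ≤ P2 ∧ 0 ≤ Q0 ∧ 0 ≤ Q1 ∧ 0 ≤ Q2 ∧
        y 0 - xt a b y t = P0 - Q0 ∧
        y 1 - (3 * mm a b y t - xt a b y t - xb a b y t) = P1 - Q1 ∧
        y 2 - xb a b y t = P2 - Q2 ∧ P0 + P1 + P2 = a * t ∧ Q0 + Q1 + Q2 = b * t ∧
        P1 * (xt a b y t - (3 * mm a b y t - xt a b y t - xb a b y t)) = 0 ∧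
        P2 * (xt a b y t - xb a b y t) = 0 ∧ Q0 * (xt a b y t - xb a b y t) = 0 ∧
        Q1 * ((3 * mm a b y t - xt a b y t - xb a b y t) - xb a b y t) = 0 := by
      unfold xt xb
      rw [e]
      exact key_aux _ _ _ _ _ hat hbt hy01 hy12
    obtain ⟨P0, P1, P2, Q0, Q1, Q2, a1, a2, a3, a4, a5, a6, a7, a8, a9, a10, a11, a12, a13, a14,
      a15⟩ := key
    exact W P0 P1 P2 Q0 Q1 Q2 a1 a2 a3 a4 a5 a6 a7 a8 a9 a10 a11 a12 a13 a14 a15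

lemma sorted_spectral (A : Mat3) (h : A.IsHermitian) :
    ∃ (U : Mat3) (y : Fin 3 → ℝ), U * Uᵀ = 1 ∧ Uᵀ * U = 1 ∧ y 1 ≤ y 0 ∧ y 2 ≤ y 1 ∧
      A = U * diagonal y * Uᵀ := by
  obtain ⟨U, h1, h2, h3⟩ := spectral A h
  set v := h.eigenvalues
  let s : Equiv.Perm (Fin 3) := Tuple.sort (fun i => - v i)
  have hs : Monotone ((fun i => - v i) ∘ s) := Tuple.monotone_sort _
  have e : (U.submatrix id s)ᵀ = Uᵀ.submatrix s id := rfl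
  refine ⟨U.submatrix id s, v ∘ s, ?_, ?_, ?_, ?_, ?_⟩
  · rw [e, Matrix.submatrix_mul_equiv, h1]; simp
  · rw [e, ← Matrix.submatrix_mul _ _ _ _ _ Function.bijective_id, h2]
    ext i j; simp [Matrix.one_apply]
  · have := hs (show (0 : Fin 3) ≤ 1 by decide)
    simpa using this
  · have := hs (show (1 : Fin 3) ≤ 2 by decide)
    simpa using this
  · rw [e, ← Matrix.submatrix_diagonal_equiv, Matrix.submatrix_mul_equiv,
      Matrix.submatrix_mul_equiv, ← h3]; simp

lemma pos_aux (K G l S1 S2 : ℝ) (hK : 0 < K) (hG : 0 < G) (hl : 0 < l) (p1 : 0 ≤ S1) (p2 : 0 ≤ S2)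
    (h : 0 ≤ - l * (K * S1 + 2 * G * S2)) : S1 = 0 ∧ S2 = 0 := by
  have a1 := mul_nonneg hK.le p1
  have a2 := mul_nonneg hG.le p2
  have tot : K * S1 + 2 * G * S2 ≤ 0 := by
    by_contra hcon
    push Not at hcon
    linarith [mul_pos hl hcon]
  have b1 : K * S1 = 0 := by linarith
  have b2 : G * S2 = 0 := by linarith
  have c1 := hK.ne'
  have c2 := hG.ne'
  exact ⟨(mul_eq_zero.1 b1).resolve_left c1, (mul_eq_zero.1 b2).resolve_left c2⟩

/-- Uniqueness of the stress for fixed multiplier. -/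
lemma sigma_unique (K G ψ : ℝ) (hK : 0 < K) (hG : 0 < G) (σtr σ₁ σ₂ ν₁ ν₂ : Mat3) (l : ℝ)
    (hl : 0 ≤ l) (h1 : σ₁.IsHermitian) (h2 : σ₂.IsHermitian)
    (n1 : ν₁ ∈ subdiff (MCg ψ) σ₁) (n2 : ν₂ ∈ subdiff (MCg ψ) σ₂)
    (e1 : σ₁ = σtr - l • De K G ν₁) (e2 : σ₂ = σtr - l • De K G ν₂) : σ₁ = σ₂ := by
  rcases hl.eq_or_lt with rfl | hl
  · rw [e1, e2]; simp
  have i1 := n1.2 σ₂ h2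
  have i2 := n2.2 σ₁ h1
  have hN : (ν₁ - ν₂).IsHermitian := n1.1.sub n2.1
  have eD : σ₁ - σ₂ = - (l • De K G (ν₁ - ν₂)) := by
    rw [e1, e2]; unfold De
    ext i j
    simp [Matrix.trace_sub]
    ring
  have i3 : 0 ≤ frob (ν₁ - ν₂) (σ₁ - σ₂) := by
    have : frob (ν₁ - ν₂) (σ₁ - σ₂) = - frob ν₁ (σ₂ - σ₁) - frob ν₂ (σ₁ - σ₂) := by
      simp only [frob_sub]
      simp only [frob, Matrix.sub_mul, Matrix.trace_sub, Matrix.mul_sub]; ring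
    linarith
  rw [eD] at i3
  suffices hz : ν₁ - ν₂ = 0 by
    have := sub_eq_zero.1 hz
    rw [e1, e2, this]
  generalize ν₁ - ν₂ = N at *
  have s : ∀ i j, N i j = N j i := fun i j => by
    have := hN.apply j i
    simpa using this
  have i4 : frob N (-(l • De K G N)) = - l * (K * (N 0 0 + N 1 1 + N 2 2) ^ 2 +
      2 * G * (((N 0 0 - N 1 1) ^ 2 + (N 1 1 - N 2 2) ^ 2 + (N 0 0 - N 2 2) ^ 2) / 3 +
        2 * (N 0 1 ^ 2 + N 0 2 ^ 2 + N 1 2 ^ 2))) := by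
    simp [frob, De, Matrix.trace, Matrix.mul_apply, Fin.sum_univ_three, s 1 0, s 2 0, s 2 1]
    ring
  rw [i4] at i3
  obtain ⟨z1, z2⟩ := pos_aux K G l _ _ hK hG hl (by positivity) (by positivity) i3
  have t : N 0 0 + N 1 1 + N 2 2 = 0 := by exact pow_eq_zero_iff (two_ne_zero) |>.1 z1
  have sq0 : ∀ r : ℝ, r ^ 2 ≤ 0 → r = 0 := fun r hr => pow_eq_zero_iff (two_ne_zero) |>.1
    (le_antisymm hr (sq_nonneg r))
  have q1 := sq_nonneg (N 0 0 - N 1 1)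
  have q2 := sq_nonneg (N 1 1 - N 2 2)
  have q3 := sq_nonneg (N 0 0 - N 2 2)
  have q4 := sq_nonneg (N 0 1)
  have q5 := sq_nonneg (N 0 2)
  have q6 := sq_nonneg (N 1 2)
  have r1 := sq0 (N 0 0 - N 1 1) (by linarith)
  have r2 := sq0 (N 1 1 - N 2 2) (by linarith)
  have r4 := sq0 (N 0 1) (by linarith)
  have r5 := sq0 (N 0 2) (by linarith)
  have r6 := sq0 (N 1 2) (by linarith)
  ext i j
  fin_cases i <;> fin_cases j <;> simp [s 1 0, s 2 0, s 2 1, r4, r5, r6] <;> linarith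

/-- Monotonicity of the deviatoric extreme eigenvalues. -/
lemma dev_mono (s t₁ t₂ : ℝ) (hs : 0 < s) (hs1 : s < 1) (h : t₁ ≤ t₂) (y : Fin 3 → ℝ) :
    xt (1 + s) (1 - s) y t₂ + 2 * s / 3 * t₂ ≤ xt (1 + s) (1 - s) y t₁ + 2 * s / 3 * t₁ ∧
    xb (1 + s) (1 - s) y t₁ + 2 * s / 3 * t₁ ≤ xb (1 + s) (1 - s) y t₂ + 2 * s / 3 * t₂ := by
  have k : s * t₁ ≤ s * t₂ := by nlinarith
  have k' : (1 - s) * t₁ ≤ (1 - s) * t₂ := by nlinarith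
  constructor
  · have : xt (1 + s) (1 - s) y t₂ ≤ xt (1 + s) (1 - s) y t₁ + 2 * s / 3 * t₁ - 2 * s / 3 * t₂ := by
      have l1 : y 0 - (1 + s) * t₁ ≤ xt (1 + s) (1 - s) y t₁ := by unfold xt; simp
      have l2 : (y 0 + y 1 - (1 + s) * t₁) / 2 ≤ xt (1 + s) (1 - s) y t₁ := by unfold xt; simp
      have l3 : mm (1 + s) (1 - s) y t₁ ≤ xt (1 + s) (1 - s) y t₁ := by unfold xt; simp
      unfold mm at l3
      conv_lhs => unfold xt mm
      apply max_le (max_le _ _) <;> nlinarith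
    linarith
  · have : xb (1 + s) (1 - s) y t₁ + 2 * s / 3 * t₁ - 2 * s / 3 * t₂ ≤ xb (1 + s) (1 - s) y t₂ := by
      have l1 : xb (1 + s) (1 - s) y t₁ ≤ y 2 + (1 - s) * t₁ := by unfold xb; simp
      have l2 : xb (1 + s) (1 - s) y t₁ ≤ (y 1 + y 2 + (1 - s) * t₁) / 2 := by unfold xb; simp
      have l3 : xb (1 + s) (1 - s) y t₁ ≤ mm (1 + s) (1 - s) y t₁ := by unfold xb; simp
      unfold mm at l3
      conv_rhs => unfold xb mm
      apply le_min (le_min _ _) <;> nlinarith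
    linarith

/-- Theorem 4.5 of the paper: the implicitly discretized Mohr–Coulomb
constitutive problem has exactly one solution `(σ, ε̄ᵖ, Δλ) ∈ Sym3 × ℝ × ℝ`. -/
theorem discretized_constitutive_problem_unique_solution
    (K G c₀ φ ψ : ℝ) (hK : 0 < K) (hG : 0 < G) (hc₀ : 0 < c₀)
    (hφ : φ ∈ Set.Ioo 0 (Real.pi / 2)) (hψ : ψ ∈ Set.Ioo 0 (Real.pi / 2))
    (H : ℝ → ℝ) (hmono : Monotone H) (hcont : Continuous H) (hH0 : H 0 = 0)
    (σtr : Mat3) (hσtr : σtr.IsHermitian) (εtr : ℝ) :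
    ∃! p : Mat3 × ℝ × ℝ,
      p.1.IsHermitian ∧
      0 ≤ p.2.2 ∧
      p.2.1 = εtr + 2 * p.2.2 * Real.cos φ ∧
      MCf φ c₀ p.1 (H p.2.1) ≤ 0 ∧
      p.2.2 * MCf φ c₀ p.1 (H p.2.1) = 0 ∧
      ∃ ν ∈ subdiff (MCg ψ) p.1, p.1 = σtr - p.2.2 • De K G ν := by
  have hcf : 0 < Real.cos φ := Real.cos_pos_of_mem_Ioo ⟨by linarith [hφ.1, Real.pi_pos], hφ.2⟩
  have hcp : 0 < Real.cos ψ := Real.cos_pos_of_mem_Ioo ⟨by linarith [hψ.1, Real.pi_pos], hψ.2⟩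
  have hsf : 0 < Real.sin φ := Real.sin_pos_of_pos_of_lt_pi hφ.1 (by linarith [hφ.2, Real.pi_pos])
  have hsp : 0 < Real.sin ψ := Real.sin_pos_of_pos_of_lt_pi hψ.1 (by linarith [hψ.2, Real.pi_pos])
  have hsf1 : Real.sin φ < 1 := by nlinarith [Real.sin_sq_add_cos_sq φ]
  have hsp1 : Real.sin ψ < 1 := by nlinarith [Real.sin_sq_add_cos_sq ψ]
  obtain ⟨U, y, hU, hU', hy01, hy12, hσ⟩ := sorted_spectral σtr hσtr
  obtain ⟨c, hc⟩ : ∃ c, c = (1 / 3) * (3 * K - 2 * G) * (2 * Real.sin ψ) := ⟨_, rfl⟩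
  let z : ℝ → Fin 3 → ℝ := fun l i =>
    xx (1 + Real.sin ψ) (1 - Real.sin ψ) y (2 * G * l) i - l * c
  let Sl : ℝ → Mat3 := fun l => U * diagonal (z l) * Uᵀ
  have hherm : ∀ l, (Sl l).IsHermitian := fun l => herm_rot _ _
  have hz : ∀ l, 0 ≤ l → z l 1 ≤ z l 0 ∧ z l 2 ≤ z l 1 := by
    intro l hl
    have := scalar_sorted (1 + Real.sin ψ) (1 - Real.sin ψ) (2 * G * l) (by linarith)
      (by linarith) (by positivity) y hy01 hy12
    constructor
    · simp only [z]; linarith [this.1]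
    · simp only [z]; linarith [this.2]
  have hsol : ∀ l, 0 ≤ l → ∃ ν ∈ subdiff (MCg ψ) (Sl l), Sl l = σtr - l • De K G ν := by
    intro l hl
    obtain ⟨p, q, hp, hq, sp, sq, cp, cq, hpq⟩ := weights (1 + Real.sin ψ) (1 - Real.sin ψ)
      (2 * G * l) (by linarith) (by linarith) (by positivity) y hy01 hy12
    refine ⟨_, subdiff_rot ψ hψ U hU hU' (z l) p q (hz l hl).1 (hz l hl).2 hp hq sp sq ?_ ?_, ?_⟩
    · intro i; rw [← cp i]; simp only [z]; ring
    · intro i; rw [← cq i]; simp only [z]; ring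
    · set d : Fin 3 → ℝ := fun i => (1 + Real.sin ψ) * p i - (1 - Real.sin ψ) * q i with hd
      have tr : (U * diagonal d * Uᵀ).trace = 2 * Real.sin ψ := by
        rw [Matrix.trace_mul_comm, ← Matrix.mul_assoc, hU', Matrix.one_mul, Matrix.trace_diagonal]
        simp only [hd, Finset.sum_sub_distrib, ← Finset.mul_sum, sp, sq]; ring
      have zd : diagonal (z l) = diagonal y - (l * c) • (1 : Mat3) - (2 * G * l) • diagonal d := by
        ext i j
        by_cases hij : i = j
        · subst hij
          have := hpq i
          simp [z, hd]; linarith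
        · simp [hij]
      simp only [Sl]
      unfold De
      rw [tr, ← hc, zd, hσ]
      simp only [Matrix.mul_sub, Matrix.sub_mul, Matrix.mul_smul, Matrix.smul_mul, Matrix.mul_one,
        hU, smul_add, smul_smul]
      rw [show l * (2 * G) = 2 * G * l by ring]
      abel
  have hom : ∀ l, 0 ≤ l → ω₁ (Sl l) = z l 0 ∧ ω₃ (Sl l) = z l 2 := fun l hl =>
    omega_rot U hU hU' (z l) (hz l hl).1 (hz l hl).2
  let F : ℝ → ℝ := fun l => (1 + Real.sin φ) * z l 0 - (1 - Real.sin φ) * z l 2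
  let Q : ℝ → ℝ := fun l => F l - 2 * (c₀ + H (εtr + 2 * l * Real.cos φ)) * Real.cos φ
  have hMC : ∀ l, 0 ≤ l → MCf φ c₀ (Sl l) (H (εtr + 2 * l * Real.cos φ)) = Q l := by
    intro l hl
    simp only [MCf, Q, F, (hom l hl).1, (hom l hl).2]
  have hF : ∀ l₁ l₂, l₁ ≤ l₂ →
      F l₂ ≤ F l₁ - 4 * Real.sin φ * Real.sin ψ * K * (l₂ - l₁) := by
    intro l₁ l₂ h
    obtain ⟨d1, d2⟩ := dev_mono (Real.sin ψ) (2 * G * l₁) (2 * G * l₂) hsp hsp1 (by gcongr) y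
    have m1 := mul_le_mul_of_nonneg_left d1 (show 0 ≤ 1 + Real.sin φ by linarith)
    have m2 := mul_le_mul_of_nonneg_left d2 (show 0 ≤ 1 - Real.sin φ by linarith)
    simp only [F, z, xx, Matrix.cons_val, hc]
    nlinarith
  have hFc : Continuous F := by
    have : Continuous fun l => z l 0 := by
      simp only [z, xx, Matrix.cons_val]; unfold xt mm; fun_prop
    have : Continuous fun l => z l 2 := by
      simp only [z, xx, Matrix.cons_val]; unfold xb mm; fun_prop
    fun_prop
  have hQc : Continuous Q := by fun_prop
  have hpos : 0 < 4 * Real.sin φ * Real.sin ψ * K := by positivity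
  have hQ : ∀ l₁ l₂, l₁ < l₂ → Q l₂ < Q l₁ := by
    intro l₁ l₂ h
    have a1 := hF l₁ l₂ h.le
    have a2 := mul_pos hpos (sub_pos.2 h)
    have a3 : H (εtr + 2 * l₁ * Real.cos φ) ≤ H (εtr + 2 * l₂ * Real.cos φ) := by
      apply hmono; gcongr
    have a4 := mul_le_mul_of_nonneg_right a3 hcf.le
    simp only [Q]
    linarith
  have hex : ∃ l, 0 ≤ l ∧ Q l ≤ 0 ∧ l * Q l = 0 := by
    by_cases h0 : Q 0 ≤ 0
    · exact ⟨0, le_rfl, h0, by simp⟩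
    push Not at h0
    obtain ⟨L, hL⟩ : ∃ L, L = |εtr| / (2 * Real.cos φ) +
        |F 0| / (4 * Real.sin φ * Real.sin ψ * K) := ⟨_, rfl⟩
    have b1 : 0 ≤ |εtr| / (2 * Real.cos φ) := by positivity
    have b2 : 0 ≤ |F 0| / (4 * Real.sin φ * Real.sin ψ * K) := by positivity
    have hL0 : 0 ≤ L := by linarith
    have k1 : |εtr| ≤ L * (2 * Real.cos φ) := by
      rw [← div_le_iff₀ (by positivity)]; linarith
    have k2 : |F 0| ≤ L * (4 * Real.sin φ * Real.sin ψ * K) := by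
      rw [← div_le_iff₀ (by positivity)]; linarith
    have k3 : 0 ≤ H (εtr + 2 * L * Real.cos φ) := by
      rw [← hH0]; apply hmono; linarith [neg_abs_le εtr]
    have k4 := hF 0 L hL0
    have hQL : Q L ≤ 0 := by
      have k5 : 0 ≤ 2 * (c₀ + H (εtr + 2 * L * Real.cos φ)) * Real.cos φ := by positivity
      simp only [Q]
      linarith [le_abs_self (F 0)]
    obtain ⟨l, hl, hl0⟩ := intermediate_value_Icc' hL0 hQc.continuousOn ⟨hQL, h0.le⟩
    exact ⟨l, hl.1, hl0.le, by rw [hl0, mul_zero]⟩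
  obtain ⟨l, hl, hl1, hl2⟩ := hex
  refine ⟨(Sl l, εtr + 2 * l * Real.cos φ, l), ⟨hherm l, hl, rfl, ?_, ?_, hsol l hl⟩, ?_⟩
  · simpa only [hMC l hl] using hl1
  · simpa only [hMC l hl] using hl2
  · rintro ⟨σ, ε, k⟩ ⟨g1, g2, g3, g4, g5, ν, g6, g7⟩
    simp only at g1 g2 g3 g4 g5 g6 g7
    obtain ⟨ν', n1, n2⟩ := hsol k g2
    have es : σ = Sl k := sigma_unique K G ψ hK hG σtr _ _ ν ν' k g2 g1 (hherm k) g6 n1 g7 n2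
    rw [es, g3, hMC k g2] at g4 g5
    have ek : k = l := by
      rcases lt_trichotomy k l with h | h | h
      · have := hQ _ _ h
        rcases mul_eq_zero.1 hl2 with h' | h' <;> linarith
      · exact h
      · have := hQ _ _ h
        rcases mul_eq_zero.1 g5 with h' | h' <;> linarith
    subst ek
    rw [es, g3]
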